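/- Let p be a prime, K a field of characteristic p, and a, b, c, d, e ∈ K with a − b + e ≠ 0. Setting r = (c + d − 1)/(a − b + e), one has I_p(a + r, b + r, 1 − d, 1 − c, e) = I_p(a, b, c, d, e); that is, the integral of motion I_p is invariant under the Weyl group generator s₀. -/

import Mathlib

open MvPolynomial

noncomputable section

/-- The polynomial ring `R = 𝔽_p[f, g, α₁, α₂, t]`, with the five indeterminates
indexed by `0, 1, 2, 3, 4` respectively. -/
abbrev R (p : ℕ) := MvPolynomial (Fin 5) (ZMod p)

def fP (p : ℕ) : R p := X 0
def gP (p : ℕ) : R p := X 1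
def a1P (p : ℕ) : R p := X 2
def a2P (p : ℕ) : R p := X 3
def tP (p : ℕ) : R p := X 4

/-- `h = f·g·(t·g − 1)·(t·f − 1) + α₁·(t·g − 1) − α₂·(t·f − 1)`. -/
def hP (p : ℕ) : R p :=
  fP p * gP p * (tP p * gP p - 1) * (tP p * fP p - 1)
    + a1P p * (tP p * gP p - 1) - a2P p * (tP p * fP p - 1)

def A0 (p : ℕ) : Matrix (Fin 2) (Fin 2) (R p) :=
  !![-(a1P p) * gP p + fP p * gP p ^ 2 - tP p * fP p ^ 2 * gP p ^ 2, -(fP p * gP p);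
     fP p * gP p * hP p - a1P p * a2P p, -(a2P p) * fP p - fP p ^ 2 * gP p + tP p * fP p ^ 2 * gP p ^ 2]

def A1 (p : ℕ) : Matrix (Fin 2) (Fin 2) (R p) := !![0, 1; hP p, 0]

def A2 (p : ℕ) : Matrix (Fin 2) (Fin 2) (R p) :=
  !![tP p, 0; 1 - tP p ^ 2 * fP p * gP p, -(tP p)]

def A3 (p : ℕ) : Matrix (Fin 2) (Fin 2) (R p) := !![0, 0; -(tP p ^ 2), 0]

/-- The Lax coefficient matrix `A(z) = A₀ + z·A₁ + z²·A₂ + z³·A₃`, with entries in any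
commutative ring `S` receiving a ring homomorphism from `R`. -/
def AM (p : ℕ) {S : Type*} [CommRing S] (φ : R p →+* S) (z : S) : Matrix (Fin 2) (Fin 2) S :=
  (A0 p).map φ + z • (A1 p).map φ + z ^ 2 • (A2 p).map φ + z ^ 3 • (A3 p).map φ

/-- The integral of motion `I_p = Tr[A(p−1)·A(p−2)·⋯·A(1)·A(0)] ∈ R`. -/
def Ip (p : ℕ) : R p :=
  Matrix.trace (((List.range p).reverse.map (fun k => AM p (RingHom.id (R p)) (k : R p))).prod)

/-- Evaluation of a polynomial `P ∈ R` at a point `(a,b,c,d,e) ∈ K⁵` of a field (or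
commutative ring) of characteristic `p`. -/
def evalP (p : ℕ) (P : R p) (K : Type*) [CommRing K] [CharP K p] (a b c d e : K) : K :=
  eval₂ (ZMod.castHom (dvd_refl p) K) ![a, b, c, d, e] P

end

/-- The Lax matrix `A(z)` evaluated at a point `(f, g, x, y, t)` of a commutative ring. -/
def laxMatrix {S : Type*} [CommRing S] (f g x y t z : S) : Matrix (Fin 2) (Fin 2) S :=
  !![-x * g + f * g ^ 2 - t * f ^ 2 * g ^ 2 + z ^ 2 * t, -(f * g) + z;
     f * g * (f * g * (t * g - 1) * (t * f - 1) + x * (t * g - 1) - y * (t * f - 1)) - x * y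
       + z * (f * g * (t * g - 1) * (t * f - 1) + x * (t * g - 1) - y * (t * f - 1))
       + z ^ 2 * (1 - t ^ 2 * f * g) - z ^ 3 * t ^ 2,
     -y * f - f ^ 2 * g + t * f ^ 2 * g ^ 2 - z ^ 2 * t]

/-- The ordered product `A(z + n - 1) ⋯ A(z + 1) A(z)`. -/
def laxProd {S : Type*} [CommRing S] (f g x y t z : S) (n : ℕ) : Matrix (Fin 2) (Fin 2) S :=
  ((List.range n).reverse.map fun k : ℕ => laxMatrix f g x y t (z + k)).prod

lemma laxProd_succ {S : Type*} [CommRing S] (f g x y t z : S) (n : ℕ) :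
    laxProd f g x y t z (n + 1) = laxMatrix f g x y t (z + n) * laxProd f g x y t z n := by
  simp [laxProd, List.range_succ]

lemma laxMatrix_map {S T : Type*} [CommRing S] [CommRing T] (φ : S →+* T) (f g x y t z : S) :
    φ.mapMatrix (laxMatrix f g x y t z)
      = laxMatrix (φ f) (φ g) (φ x) (φ y) (φ t) (φ z) := by
  ext i j
  fin_cases i <;> fin_cases j <;> simp [laxMatrix]

lemma laxProd_map {S T : Type*} [CommRing S] [CommRing T] (φ : S →+* T) (f g x y t z : S)
    (n : ℕ) :
    φ.mapMatrix (laxProd f g x y t z n)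
      = laxProd (φ f) (φ g) (φ x) (φ y) (φ t) (φ z) n := by
  induction n with
  | zero => simp [laxProd]
  | succ n ih => rw [laxProd_succ, laxProd_succ, map_mul, ih, laxMatrix_map, map_add, map_natCast]

lemma AM_id_eq_laxMatrix (p : ℕ) (z : R p) :
    AM p (RingHom.id (R p)) z = laxMatrix (fP p) (gP p) (a1P p) (a2P p) (tP p) z := by
  ext i j
  fin_cases i <;> fin_cases j <;> simp [AM, A0, A1, A2, A3, hP, laxMatrix] <;> ring

lemma evalP_Ip (p : ℕ) (K : Type*) [CommRing K] [CharP K p] (a b c d e : K) :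
    evalP p (Ip p) K a b c d e = (laxProd a b c d e 0 p).trace := by
  have hIp : Ip p = (laxProd (fP p) (gP p) (a1P p) (a2P p) (tP p) 0 p).trace := by
    simp [Ip, laxProd, AM_id_eq_laxMatrix, ← List.map_eq_flatMap, Function.comp_def]
  have hmap := laxProd_map (eval₂Hom (ZMod.castHom (dvd_refl p) K) ![a, b, c, d, e])
    (fP p) (gP p) (a1P p) (a2P p) (tP p) 0 p
  simp only [fP, gP, a1P, a2P, tP, eval₂Hom_X', map_zero] at hmap
  change eval₂Hom (ZMod.castHom (dvd_refl p) K) ![a, b, c, d, e] (Ip p) = _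
  rw [hIp, AddMonoidHom.map_trace]
  exact congrArg Matrix.trace hmap

/-- The matrix of the gauge transformation realizing `s₀`, where `r = (x + y - 1) / (f - g + t)`. -/
def gaugeMatrix {S : Type*} [CommRing S] (f g y t r z : S) : Matrix (Fin 2) (Fin 2) S :=
  let P := t * (f * g - 1) - f
  let Q := g + r - t * (f + r) * (g + r)
  !![y - 1 + r * P + z * (1 + r * t), r;
     (y - 1) * (f - g + t + P + Q) + r * P * Q
       + z * (f - g + t + P + Q + t * r * (Q - P)) - z ^ 2 * (r * t ^ 2),
     y - 1 + r * Q + z * (1 - r * t)]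

lemma gaugeMatrix_det {S : Type*} [CommRing S] (f g x y t r z : S)
    (hr : r * (f - g + t) = x + y - 1) :
    (gaugeMatrix f g y t r z).det = (z - x) * (z + (y - 1)) := by
  obtain rfl : x = 1 - y + r * (f - g + t) := by rw [hr]; ring
  simp only [gaugeMatrix, Matrix.det_fin_two_of]
  ring

lemma gaugeMatrix_intertwines {S : Type*} [CommRing S] (f g x y t r z : S)
    (hr : r * (f - g + t) = x + y - 1) :
    (z + (y - 1)) • (gaugeMatrix f g y t r (z + 1) * laxMatrix f g x y t z)
      = (z + y) • (laxMatrix (f + r) (g + r) (1 - y) (1 - x) t z * gaugeMatrix f g y t r z) := by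
  obtain rfl : x = 1 - y + r * (f - g + t) := by rw [hr]; ring
  simp only [gaugeMatrix, laxMatrix]
  ext i j
  fin_cases i <;> fin_cases j <;> simp <;> ring

lemma gaugeMatrix_intertwines_laxProd {S : Type*} [CommRing S] [IsDomain S] (f g x y t r z : S)
    (hr : r * (f - g + t) = x + y - 1) (hz : ∀ n : ℕ, z + n + (y - 1) ≠ 0) (n : ℕ) :
    (z + (y - 1)) • (gaugeMatrix f g y t r (z + n) * laxProd f g x y t z n)
      = (z + n + (y - 1)) •
        (laxProd (f + r) (g + r) (1 - y) (1 - x) t z n * gaugeMatrix f g y t r z) := by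
  induction n with
  | zero => simp [laxProd]
  | succ n ih =>
    have step := gaugeMatrix_intertwines f g x y t r (z + n) hr
    apply smul_right_injective _ (hz n)
    simp only [laxProd_succ, Nat.cast_succ, ← add_assoc]
    rw [smul_comm, ← Matrix.mul_assoc, ← Matrix.smul_mul, step, Matrix.smul_mul, Matrix.mul_assoc,
      smul_comm, ← Matrix.mul_smul, ih, Matrix.mul_smul, smul_comm, Matrix.mul_assoc,
      add_assoc _ (1 : S), add_sub_cancel]

lemma trace_laxProd_invariant {S : Type*} [CommRing S] [IsDomain S] (p : ℕ) [CharP S p]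
    (f g x y t r z : S) (hr : r * (f - g + t) = x + y - 1)
    (hz : ∀ n : ℕ, z + n + (y - 1) ≠ 0) (hx : z - x ≠ 0) :
    (laxProd (f + r) (g + r) (1 - y) (1 - x) t z p).trace = (laxProd f g x y t z p).trace := by
  have hz₀ : z + (y - 1) ≠ 0 := by simpa using hz 0
  have key := gaugeMatrix_intertwines_laxProd f g x y t r z hr hz p
  rw [CharP.cast_eq_zero, add_zero] at key
  have comm := smul_right_injective _ hz₀ key
  have hdet : (gaugeMatrix f g y t r z).det ≠ 0 := by
    rw [gaugeMatrix_det f g x y t r z hr]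
    exact mul_ne_zero hx hz₀
  apply mul_left_cancel₀ hdet
  have htr := congrArg (fun M => (M * (gaugeMatrix f g y t r z).adjugate).trace) comm
  beta_reduce at htr
  rw [Matrix.mul_assoc _ (gaugeMatrix f g y t r z), Matrix.mul_adjugate, Matrix.trace_mul_comm,
    ← Matrix.mul_assoc, Matrix.adjugate_mul] at htr
  simpa using htr.symm

/-- The integral of motion `I_p` is invariant under the Weyl group
generator `s₀`. -/
theorem Ip_invariant_s0 (p : ℕ) (hp : p.Prime) (K : Type*) [Field K] [CharP K p]
    (a b c d e : K) (habe : a - b + e ≠ 0) :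
    evalP p (Ip p) K
      (a + (c + d - 1) / (a - b + e)) (b + (c + d - 1) / (a - b + e)) (1 - d) (1 - c) e
    = evalP p (Ip p) K a b c d e := by
  rw [evalP_Ip, evalP_Ip]
  obtain ⟨r, hr⟩ : ∃ r, r = (c + d - 1) / (a - b + e) := ⟨_, rfl⟩
  rw [← hr]
  have hr' : r * (a - b + e) = c + d - 1 := by rw [hr, div_mul_cancel₀ _ habe]
  -- Replacing `A(k)` by `A(X + k)` makes the gauge matrix invertible over `K(X)`.
  have generic := trace_laxProd_invariant p (Polynomial.C a) (Polynomial.C b) (Polynomial.C c)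
    (Polynomial.C d) (Polynomial.C e) (Polynomial.C r) Polynomial.X
    (by simpa using congrArg Polynomial.C hr')
    (fun n => by
      have := Polynomial.X_add_C_ne_zero ((n : K) + (d - 1))
      simpa [add_assoc] using this)
    (Polynomial.X_sub_C_ne_zero c)
  have eval_zero := congrArg (Polynomial.evalRingHom (0 : K)) generic
  rw [AddMonoidHom.map_trace, AddMonoidHom.map_trace] at eval_zero
  change (RingHom.mapMatrix (Polynomial.evalRingHom (0 : K)) _).trace
    = (RingHom.mapMatrix (Polynomial.evalRingHom (0 : K)) _).trace at eval_zero
  rw [laxProd_map, laxProd_map] at eval_zero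
  simpa using eval_zero
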